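/- If there exists an (n,w,q₁) MDS-CW code and an (n,w,q₂) MDS-CW code, with q₁, q₂ ≥ 2 and 1 ≤ w ≤ n, then there exists an (n, w, q₁ + q₂ − 1) MDS-CW code. -/

import Mathlib

/-- The weight of a word `x : Fin n → Fin q`: the number of nonzero coordinates. -/
def wt {n q : ℕ} (x : Fin n → Fin q) : ℕ :=
  (Finset.univ.filter fun i => (x i : ℕ) ≠ 0).card

/-- The support of a word `x : Fin n → Fin q`: the set of nonzero coordinates. -/
def supp {n q : ℕ} (x : Fin n → Fin q) : Finset (Fin n) :=
  Finset.univ.filter fun i => (x i : ℕ) ≠ 0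

/-- `C` is an (n,w,q) MDS-CW code: a constant-weight code of length `n` and
weight `w` over `Fin q` with minimum Hamming distance `w` such that every
`w`-element subset of `Fin n` is the support of exactly `q - 1` codewords. -/
def IsMDSCW (n w q : ℕ) (C : Finset (Fin n → Fin q)) : Prop :=
  (∀ c ∈ C, wt c = w) ∧
  (∀ c₁ ∈ C, ∀ c₂ ∈ C, c₁ ≠ c₂ → w ≤ hammingDist c₁ c₂) ∧
  (∀ S : Finset (Fin n), S.card = w → (C.filter fun c => supp c = S).card = q - 1)

theorem supp_map {n q Q : ℕ} (f : Fin q → Fin Q) (hf : ∀ a, (f a : ℕ) = 0 ↔ (a : ℕ) = 0)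
    (c : Fin n → Fin q) : supp (fun i => f (c i)) = supp c := by
  ext i
  simp [supp, hf]

theorem card_filter_map {n q Q : ℕ} (f : Fin q → Fin Q) (hi : Function.Injective f)
    (hf : ∀ a, (f a : ℕ) = 0 ↔ (a : ℕ) = 0)
    (C : Finset (Fin n → Fin q)) (S : Finset (Fin n)) :
    ((C.image fun c i => f (c i)).filter fun c => supp c = S).card
      = (C.filter fun c => supp c = S).card := by
  rw [Finset.filter_image]
  simp only [supp_map f hf]
  apply Finset.card_image_of_injective
  intro a b hab
  funext i
  exact hi (congrFun hab i)

theorem dist_cross {n q w r₁ r₂ : ℕ} (f : Fin r₁ → Fin q) (g : Fin r₂ → Fin q)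
    (hf : ∀ a, (f a : ℕ) = 0 ↔ (a : ℕ) = 0)
    (hfg : ∀ a b, f a = g b → (a : ℕ) = 0)
    (c : Fin n → Fin r₁) (d : Fin n → Fin r₂) (hc : wt c = w) :
    w ≤ hammingDist (fun i => f (c i)) (fun i => g (d i)) := by
  rw [← hc]
  unfold wt hammingDist
  apply Finset.card_le_card
  intro i hi
  simp only [Finset.mem_filter, Finset.mem_univ, true_and] at hi ⊢
  exact fun h => hi (hfg _ _ h)

/-- The union construction: from an (n,w,q₁) MDS-CW code and an (n,w,q₂)
MDS-CW code one obtains an (n,w,q₁+q₂-1) MDS-CW code. -/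
theorem mdscw_union (n w q₁ q₂ : ℕ) (hq₁ : 2 ≤ q₁) (hq₂ : 2 ≤ q₂)
    (hw1 : 1 ≤ w) (hw : w ≤ n)
    (h₁ : ∃ C : Finset (Fin n → Fin q₁), IsMDSCW n w q₁ C)
    (h₂ : ∃ C : Finset (Fin n → Fin q₂), IsMDSCW n w q₂ C) :
    ∃ C : Finset (Fin n → Fin (q₁ + q₂ - 1)), IsMDSCW n w (q₁ + q₂ - 1) C := by
  obtain ⟨C, hC1, hC2, hC3⟩ := h₁
  obtain ⟨D, hD1, hD2, hD3⟩ := h₂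
  let f : Fin q₁ → Fin (q₁ + q₂ - 1) := fun a => ⟨a, by omega⟩
  let g : Fin q₂ → Fin (q₁ + q₂ - 1) :=
    fun b => ⟨if (b : ℕ) = 0 then 0 else q₁ - 1 + b, by split <;> omega⟩
  have hf : ∀ a, (f a : ℕ) = 0 ↔ (a : ℕ) = 0 := fun a => Iff.rfl
  have hg : ∀ a, (g a : ℕ) = 0 ↔ (a : ℕ) = 0 := by
    intro a
    simp only [g]
    split <;> omega
  have fi : Function.Injective f := by
    intro a b h
    simp only [f, Fin.mk.injEq] at h
    exact Fin.ext h
  have gi : Function.Injective g := by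
    intro a b h
    simp only [g, Fin.mk.injEq] at h
    apply Fin.ext
    split_ifs at h <;> omega
  have hfg : ∀ a b, f a = g b → (a : ℕ) = 0 := by
    intro a b h
    simp only [f, g, Fin.mk.injEq] at h
    have := a.2
    split_ifs at h <;> omega
  have wtf : ∀ c ∈ C, wt (fun i => f (c i)) = w := fun c hc => by
    rw [← hC1 c hc]
    exact congrArg Finset.card (supp_map f hf c)
  have wtg : ∀ c ∈ D, wt (fun i => g (c i)) = w := fun c hc => by
    rw [← hD1 c hc]
    exact congrArg Finset.card (supp_map g hg c)
  refine ⟨(C.image fun c i => f (c i)) ∪ (D.image fun c i => g (c i)), ?_, ?_, ?_⟩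
  · intro c hc
    simp only [Finset.mem_union, Finset.mem_image] at hc
    rcases hc with ⟨c, hc, rfl⟩ | ⟨c, hc, rfl⟩
    · exact wtf c hc
    · exact wtg c hc
  · intro c hc d hd hne
    simp only [Finset.mem_union, Finset.mem_image] at hc hd
    rcases hc with ⟨c, hc, rfl⟩ | ⟨c, hc, rfl⟩ <;> rcases hd with ⟨d, hd, rfl⟩ | ⟨d, hd, rfl⟩
    · rw [hammingDist_comp (fun _ => f) (fun _ => fi)]
      exact hC2 c hc d hd (fun h => hne (by rw [h]))
    · exact dist_cross f g hf hfg c d (hC1 c hc)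
    · rw [hammingDist_comm]
      exact dist_cross f g hf hfg d c (hC1 d hd)
    · rw [hammingDist_comp (fun _ => g) (fun _ => gi)]
      exact hD2 c hc d hd (fun h => hne (by rw [h]))
  · intro S hS
    rw [Finset.filter_union, Finset.card_union_of_disjoint, card_filter_map f fi hf,
      card_filter_map g gi hg, hC3 S hS, hD3 S hS]
    · omega
    · apply Finset.disjoint_filter_filter
      rw [Finset.disjoint_left]
      intro x hx hy
      simp only [Finset.mem_image] at hx hy
      obtain ⟨c, hc, rfl⟩ := hx
      obtain ⟨d, hd, h⟩ := hy
      have := dist_cross f g hf hfg c d (hC1 c hc)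
      rw [h, hammingDist_self] at this
      omega
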